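/- For Im τ > 0 and z ∉ (1+τ)/2 + ℤ + τℤ, one has ℘̃_τ(z) = π² Σ_{n∈ℤ} (1/sin²(π(z − (1+τ)/2 − nτ)) − 1/sin²(π((1+τ)/2 + nτ))). -/

import Mathlib

open scoped Real

/-- The Weierstrass ℘-function of the lattice `ℤ + τℤ`. -/
noncomputable def wp (τ : ℂ) (z : ℂ) : ℂ :=
  1 / z ^ 2 + ∑' p : ℤ × ℤ,
    if p = 0 then 0 else
      (1 / (z + (p.1 : ℂ) + (p.2 : ℂ) * τ) ^ 2 - 1 / ((p.1 : ℂ) + (p.2 : ℂ) * τ) ^ 2)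

/-- The translated Weierstrass function `℘̃_τ(z) = ℘_τ(z + (1+τ)/2) − ℘_τ((1+τ)/2)`. -/
noncomputable def wpTilde (τ : ℂ) (z : ℂ) : ℂ :=
  wp τ (z + (1 + τ) / 2) - wp τ ((1 + τ) / 2)

/-- Euler's identity on the open upper half-plane. -/
lemma tsum_one_div_add_int_sq_of_im_pos {x : ℂ} (hx : 0 < x.im) :
    ∑' n : ℤ, 1 / (x + n) ^ 2 = (π : ℂ) ^ 2 / Complex.sin (π * x) ^ 2 := by
  have hmem : x ∈ UpperHalfPlane.upperHalfPlaneSet := hx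
  have hsin : Complex.sin (π * x) ≠ 0 :=
    sin_pi_mul_ne_zero (UpperHalfPlane.coe_mem_integerComplement ⟨x, hx⟩)
  have hd : HasDerivAt (fun y : ℂ ↦ (π : ℂ) * Complex.cot (π * y))
      (-((π : ℂ) ^ 2 / Complex.sin (π * x) ^ 2)) x := by
    have hlin : HasDerivAt (fun y : ℂ ↦ (π : ℂ) * y) π x := by
      simpa using (hasDerivAt_id x).const_mul (π : ℂ)
    have h := ((hlin.ccos.div hlin.csin hsin).const_mul (π : ℂ))
    convert! h using 1
    field_simp
    linear_combination Complex.sin_sq_add_cos_sq (π * x)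
  have h := iteratedDerivWithin_cot_pi_mul_eq_mul_tsum_div_pow (k := 1) le_rfl hmem
  rw [iteratedDerivWithin_one,
    hd.hasDerivWithinAt.derivWithin
      (UpperHalfPlane.isOpen_upperHalfPlaneSet.uniqueDiffWithinAt hmem)] at h
  simp only [pow_one, Nat.factorial_one, Nat.cast_one, mul_one, neg_mul, one_mul, neg_inj] at h
  exact h.symm

lemma summable_one_div_add_int_sq (x : ℂ) : Summable fun n : ℤ ↦ 1 / (x + n) ^ 2 := by
  simpa using EisensteinSeries.linear_right_summable x 1 (k := 2) le_rfl

/-- Euler's identity on the closed upper half-plane, by continuity from the open one. -/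
lemma tsum_one_div_add_int_sq_of_im_nonneg {x : ℂ} (hx : 0 ≤ x.im) (hn : ∀ n : ℤ, x + n ≠ 0) :
    ∑' n : ℤ, 1 / (x + n) ^ 2 = (π : ℂ) ^ 2 / Complex.sin (π * x) ^ 2 := by
  have hsin : Complex.sin (π * x) ≠ 0 := by
    refine sin_pi_mul_ne_zero ?_
    rintro ⟨n, rfl⟩
    exact hn (-n) (by simp)
  have hpath : Filter.Tendsto (fun ε : ℝ ↦ x + ε * Complex.I) (nhdsWithin 0 (Set.Ioi 0))
      (nhds x) := by
    have : Continuous fun ε : ℝ ↦ x + ε * Complex.I := by fun_prop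
    simpa using (this.tendsto 0).mono_left nhdsWithin_le_nhds
  have hsum : Filter.Tendsto (fun ε : ℝ ↦ ∑' n : ℤ, 1 / (x + ε * Complex.I + n) ^ 2)
      (nhdsWithin 0 (Set.Ioi 0)) (nhds (∑' n : ℤ, 1 / (x + n) ^ 2)) := by
    refine tendsto_tsum_of_dominated_convergence (summable_one_div_add_int_sq x).norm
      (fun n ↦ ?_) ?_
    · have hc : ContinuousAt (fun y : ℂ ↦ 1 / (y + n) ^ 2) x := by
        have := pow_ne_zero 2 (hn n)
        fun_prop (disch := assumption)
      exact hc.tendsto.comp hpath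
    · filter_upwards [self_mem_nhdsWithin] with ε hε n
      have hpos : 0 < ‖x + n‖ := norm_pos_iff.mpr (hn n)
      have hle : ‖x + n‖ ≤ ‖x + ε * Complex.I + n‖ := by
        rw [Complex.norm_def, Complex.norm_def]
        refine Real.sqrt_le_sqrt ?_
        simp only [Complex.normSq_apply, Complex.add_re, Complex.add_im, Complex.mul_re,
          Complex.mul_im, Complex.ofReal_re, Complex.ofReal_im, Complex.I_re, Complex.I_im,
          Complex.intCast_re, Complex.intCast_im]
        have hε' : 0 < ε := hε
        nlinarith [mul_nonneg hx hε'.le]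
      simp only [norm_div, norm_one, norm_pow]
      gcongr
  have hlim : Filter.Tendsto
      (fun ε : ℝ ↦ (π : ℂ) ^ 2 / Complex.sin (π * (x + ε * Complex.I)) ^ 2)
      (nhdsWithin 0 (Set.Ioi 0)) (nhds ((π : ℂ) ^ 2 / Complex.sin (π * x) ^ 2)) := by
    have hc : ContinuousAt (fun y : ℂ ↦ (π : ℂ) ^ 2 / Complex.sin (π * y) ^ 2) x := by
      have := pow_ne_zero 2 hsin
      fun_prop (disch := assumption)
    exact hc.tendsto.comp hpath
  refine tendsto_nhds_unique (hsum.congr' ?_) hlim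
  filter_upwards [self_mem_nhdsWithin] with ε hε
  refine tsum_one_div_add_int_sq_of_im_pos ?_
  have hε' : 0 < ε := hε
  simpa using add_pos_of_nonneg_of_pos hx hε'

/-- Euler's identity `∑ 1 / (x + n)² = π² / sin² (π x)` for non-integral `x`. -/
lemma tsum_one_div_add_int_sq {x : ℂ} (hn : ∀ n : ℤ, x + n ≠ 0) :
    ∑' n : ℤ, 1 / (x + n) ^ 2 = (π : ℂ) ^ 2 / Complex.sin (π * x) ^ 2 := by
  rcases le_total 0 x.im with hx | hx
  · exact tsum_one_div_add_int_sq_of_im_nonneg hx hn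
  · have h := tsum_one_div_add_int_sq_of_im_nonneg (x := -x) (by simpa using hx)
      (fun n h ↦ hn (-n) (by push_cast; linear_combination -h))
    rw [mul_neg, Complex.sin_neg, neg_sq, ← (Equiv.neg ℤ).tsum_eq] at h
    rw [← h]
    refine tsum_congr fun n ↦ ?_
    simp only [Equiv.neg_apply, Int.cast_neg]
    congr 1
    ring

/-- The period pair `(1, τ)` for `τ` in the upper half-plane. -/
def periodPairOne (τ : ℂ) (hτ : 0 < τ.im) : PeriodPair where
  ω₁ := 1
  ω₂ := τ
  indep := by
    rw [LinearIndependent.pair_iff]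
    intro s t h
    have him := congrArg Complex.im h
    have hre := congrArg Complex.re h
    simp only [Complex.real_smul, mul_one, Complex.add_im, Complex.ofReal_im, Complex.mul_im,
      Complex.ofReal_re, zero_mul, add_zero, zero_add, Complex.zero_im, mul_eq_zero,
      hτ.ne', or_false] at him
    subst him
    simpa using hre

lemma summable_wp_summand {τ : ℂ} (hτ : 0 < τ.im) (z : ℂ) :
    Summable fun p : ℤ × ℤ ↦
      1 / (z + (p.1 : ℂ) + (p.2 : ℂ) * τ) ^ 2 - 1 / ((p.1 : ℂ) + (p.2 : ℂ) * τ) ^ 2 := by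
  have h := ((periodPairOne τ hτ).hasSum_weierstrassP z).summable
  rw [← ((Equiv.neg (ℤ × ℤ)).trans
    (periodPairOne τ hτ).latticeEquivProd.symm.toEquiv).summable_iff] at h
  convert h using 2 with p
  have hp := (periodPairOne τ hτ).latticeEquiv_symm_apply (-p)
  simp only [Function.comp_apply, Equiv.trans_apply, Equiv.neg_apply, LinearEquiv.coe_toEquiv, hp]
  simp only [periodPairOne, Prod.fst_neg, Prod.snd_neg, Int.cast_neg]
  ring

lemma wp_eq_tsum {τ : ℂ} (hτ : 0 < τ.im) (z : ℂ) :
    wp τ z = ∑' p : ℤ × ℤ,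
      (1 / (z + (p.1 : ℂ) + (p.2 : ℂ) * τ) ^ 2 - 1 / ((p.1 : ℂ) + (p.2 : ℂ) * τ) ^ 2) := by
  rw [(summable_wp_summand hτ z).tsum_eq_add_tsum_ite 0, wp]
  simp

/-- The difference of two values of `℘_τ`, summed along the rows of the lattice. -/
lemma wp_sub_wp {τ : ℂ} (hτ : 0 < τ.im) {x y : ℂ}
    (hx : ∀ n m : ℤ, x + (n : ℂ) + (m : ℂ) * τ ≠ 0)
    (hy : ∀ n m : ℤ, y + (n : ℂ) + (m : ℂ) * τ ≠ 0) :
    wp τ x - wp τ y = (π : ℂ) ^ 2 * ∑' m : ℤ,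
      (1 / Complex.sin (π * (x + m * τ)) ^ 2 - 1 / Complex.sin (π * (y + m * τ)) ^ 2) := by
  have hs := (summable_wp_summand hτ x).sub (summable_wp_summand hτ y)
  rw [wp_eq_tsum hτ, wp_eq_tsum hτ,
    ← (summable_wp_summand hτ x).tsum_sub (summable_wp_summand hτ y),
    ← (Equiv.prodComm ℤ ℤ).tsum_eq, ← tsum_mul_left]
  refine ((Equiv.prodComm ℤ ℤ).summable_iff.mpr hs).tsum_prod.trans ?_
  refine tsum_congr fun m ↦ ?_
  rw [mul_sub, mul_one_div, mul_one_div,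
    ← tsum_one_div_add_int_sq (x := x + m * τ) (fun n h ↦ hx n m (by rw [← h]; ring)),
    ← tsum_one_div_add_int_sq (x := y + m * τ) (fun n h ↦ hy n m (by rw [← h]; ring)),
    ← (summable_one_div_add_int_sq _).tsum_sub (summable_one_div_add_int_sq _)]
  refine tsum_congr fun n ↦ ?_
  simp only [Function.comp_apply, Equiv.prodComm_apply, Prod.fst_swap, Prod.snd_swap]
  rw [sub_sub_sub_cancel_right, add_right_comm x, add_right_comm y]

lemma half_period_add_ne_zero {τ : ℂ} (hτ : 0 < τ.im) (n m : ℤ) :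
    (1 + τ) / 2 + (n : ℂ) + (m : ℂ) * τ ≠ 0 := by
  intro h
  have him := congrArg Complex.im (show (1 + 2 * m) * τ + (1 + 2 * n) = 0 by
    linear_combination 2 * h)
  have hm : (1 + 2 * m : ℝ) * τ.im = 0 := by simpa using him
  have hm' : (1 + 2 * m : ℝ) = 0 := (mul_eq_zero.mp hm).resolve_right hτ.ne'
  norm_cast at hm'
  omega

theorem stmt10 (τ : ℂ) (hτ : 0 < τ.im) (z : ℂ)
    (hz : ∀ n m : ℤ, z ≠ (1 + τ) / 2 + (n : ℂ) + (m : ℂ) * τ) :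
    wpTilde τ z = (π : ℂ) ^ 2 * ∑' n : ℤ,
      (1 / Complex.sin ((π : ℂ) * (z - (1 + τ) / 2 - (n : ℂ) * τ)) ^ 2
        - 1 / Complex.sin ((π : ℂ) * ((1 + τ) / 2 + (n : ℂ) * τ)) ^ 2) := by
  have hz' : ∀ n m : ℤ, z + (1 + τ) / 2 + (n : ℂ) + (m : ℂ) * τ ≠ 0 := fun n m h ↦
    hz (-n - 1) (-m - 1) (by push_cast; linear_combination h)
  rw [wpTilde, wp_sub_wp hτ hz' (half_period_add_ne_zero hτ), ← (Equiv.subLeft (-1 : ℤ)).tsum_eq]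
  congr 1
  refine tsum_congr fun n ↦ ?_
  have hleft : (π : ℂ) * (z + (1 + τ) / 2 + ((-1 - n : ℤ) : ℂ) * τ)
      = π * (z - (1 + τ) / 2 - n * τ) + π := by
    push_cast
    ring
  have hright : (π : ℂ) * ((1 + τ) / 2 + ((-1 - n : ℤ) : ℂ) * τ)
      = π - π * ((1 + τ) / 2 + n * τ) := by
    push_cast
    ring
  rw [Equiv.subLeft_apply, hleft, hright, Complex.sin_add_pi, Complex.sin_pi_sub, neg_sq]
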